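/- Let k ≥ 1, let x : Fin k → ℝ be betting odds with x i > 1 for all i, and let t : ℝ satisfy 0 < t and t < ∑ i, (x i)⁻¹. Then there exists a unique β > 1 such that ∑ i, (x i) ^ (-β) = t (real powers). In particular, the power conversion is well defined: when the booksum exceeds the number of successful outcomes, there is exactly one power constant β > 1 making the implied probabilities x i^(−β) sum to t. -/

import Mathlib

theorem sum_rpow_neg_continuous {ι : Type*} [Fintype ι] {x : ι → ℝ} (hx : ∀ i, 0 < x i) :
    Continuous fun β : ℝ => ∑ i, x i ^ (-β) :=
  continuous_finsetSum _ fun i _ =>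
    (Real.continuous_const_rpow (hx i).ne').comp continuous_neg

theorem sum_rpow_neg_strictAnti {ι : Type*} [Fintype ι] [Nonempty ι] {x : ι → ℝ}
    (hx : ∀ i, 1 < x i) : StrictAnti fun β : ℝ => ∑ i, x i ^ (-β) := fun _ _ h =>
  Finset.sum_lt_sum_of_nonempty Finset.univ_nonempty fun i _ =>
    Real.rpow_lt_rpow_of_exponent_lt (hx i) (neg_lt_neg h)

theorem sum_rpow_neg_tendsto_zero {ι : Type*} [Fintype ι] {x : ι → ℝ} (hx : ∀ i, 1 < x i) :
    Filter.Tendsto (fun β : ℝ => ∑ i, x i ^ (-β)) Filter.atTop (nhds 0) := by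
  rw [← Finset.sum_const_zero (ι := ι) (s := Finset.univ)]
  exact tendsto_finsetSum _ fun i _ =>
    (tendsto_rpow_atBot_of_base_gt_one (x i) (hx i)).comp Filter.tendsto_neg_atTop_atBot

theorem power_conversion_well_defined
    (k : ℕ) (hk : 1 ≤ k) (x : Fin k → ℝ) (hx : ∀ i, 1 < x i)
    (t : ℝ) (ht : 0 < t) (ht' : t < ∑ i, (x i)⁻¹) :
    ∃! β : ℝ, 1 < β ∧ (∑ i, (x i) ^ (-β)) = t := by
  have : Nonempty (Fin k) := ⟨⟨0, hk⟩⟩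
  have hanti := sum_rpow_neg_strictAnti hx
  have hcont := sum_rpow_neg_continuous fun i => zero_lt_one.trans (hx i)
  have h_one : t < ∑ i, x i ^ (-(1 : ℝ)) := by simpa only [Real.rpow_neg_one] using ht'
  obtain ⟨b, hb⟩ := ((sum_rpow_neg_tendsto_zero hx).eventually_lt_const ht).exists
  obtain ⟨β, hβ⟩ := mem_range_of_exists_le_of_exists_ge hcont ⟨b, hb.le⟩ ⟨1, h_one.le⟩
  refine ⟨β, ⟨hanti.lt_iff_gt.mp (hβ.trans_lt h_one), hβ⟩, fun γ hγ => ?_⟩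
  exact hanti.injective (hγ.2.trans hβ.symm)
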